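/- For every positive integer n, the circulant graph C_{16n+4}({1, 4n+2, 8n+1}) is edge-transitive. -/

import Mathlib

/-- A graph is edge-transitive if its automorphism group acts transitively on its edge set. -/
def EdgeTransitive {V : Type*} (G : SimpleGraph V) : Prop :=
  ∀ e₁ ∈ G.edgeSet, ∀ e₂ ∈ G.edgeSet, ∃ φ : G ≃g G, Sym2.map φ e₁ = e₂

/-- The circulant graph `C_n(L)` on vertex set `ZMod n`: distinct vertices `x`, `y` are
adjacent iff `x - y ≡ ±l (mod n)` for some `l ∈ L`. -/
def circulant (n : ℕ) (L : Finset ℤ) : SimpleGraph (ZMod n) :=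
  SimpleGraph.circulantGraph {x : ZMod n | ∃ l ∈ L, x = (l : ZMod n)}

theorem exists_perm_apply_eq_and_apply_eq {A : Type*} [DecidableEq A] {i j k l : A}
    (hij : i ≠ j) (hkl : k ≠ l) : ∃ σ : Equiv.Perm A, σ i = k ∧ σ j = l := by
  refine ⟨(Equiv.swap i k).trans (Equiv.swap (Equiv.swap i k j) l), ?_, by simp⟩
  have h : k ≠ Equiv.swap i k j := fun h => hij <| (Equiv.swap i k).injective (by simpa using h)
  simp [Equiv.swap_apply_of_ne_of_ne h hkl]

/-- An arc-transitive graph is edge-transitive. -/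
theorem edgeTransitive_of_arcTransitive {V : Type*} {G : SimpleGraph V}
    (h : ∀ x y z w, G.Adj x y → G.Adj z w → ∃ φ : G ≃g G, φ x = z ∧ φ y = w) :
    EdgeTransitive G := by
  intro e₁ h₁ e₂ h₂
  induction e₁ with | _ x y
  induction e₂ with | _ z w
  obtain ⟨φ, rfl, rfl⟩ := h x y z w h₁ h₂
  exact ⟨φ, rfl⟩

/-- A graph isomorphic to the tensor product of a complete graph with the Cayley graph of a
commutative ring `R` with respect to `±1` is edge-transitive. -/
theorem edgeTransitive_of_equiv_complete_tensor_cycle {V A R : Type*} [DecidableEq A] [CommRing R]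
    {G : SimpleGraph V} (e : V ≃ A × R)
    (he : ∀ x y, G.Adj x y ↔ (e x).1 ≠ (e y).1 ∧
      ((e x).2 - (e y).2 = 1 ∨ (e x).2 - (e y).2 = -1)) : EdgeTransitive G := by
  refine edgeTransitive_of_arcTransitive fun x y z w hxy hzw => ?_
  obtain ⟨hA, hR⟩ := (he x y).1 hxy
  obtain ⟨hA', hR'⟩ := (he z w).1 hzw
  obtain ⟨σ, hσx, hσy⟩ := exists_perm_apply_eq_and_apply_eq hA hA'
  obtain ⟨u, hu, huv⟩ : ∃ u : R, (u = 1 ∨ u = -1) ∧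
      u * ((e y).2 - (e x).2) = (e w).2 - (e z).2 := by
    rcases hR with h | h <;> rcases hR' with h' | h'
    · exact ⟨1, .inl rfl, by linear_combination h' - h⟩
    · exact ⟨-1, .inr rfl, by linear_combination h' + h⟩
    · exact ⟨-1, .inr rfl, by linear_combination h' + h⟩
    · exact ⟨1, .inl rfl, by linear_combination h' - h⟩
  have huu : u * u = 1 := by rcases hu with rfl | rfl <;> ring
  let τ : Equiv.Perm R :=
    { toFun := fun a => u * (a - (e x).2) + (e z).2
      invFun := fun a => u * (a - (e z).2) + (e x).2
      left_inv := fun a => by linear_combination (a - (e x).2) * huu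
      right_inv := fun a => by linear_combination (a - (e z).2) * huu }
  have hτ : ∀ a b, (τ a - τ b = 1 ∨ τ a - τ b = -1) ↔ (a - b = 1 ∨ a - b = -1) := by
    intro a b
    have hab : τ a - τ b = u * (a - b) := by simp only [τ, Equiv.coe_fn_mk]; ring
    rw [hab]
    rcases hu with rfl | rfl
    · simp
    · rw [neg_one_mul, neg_inj, neg_eq_iff_eq_neg, or_comm]
  refine ⟨⟨(e.trans (σ.prodCongr τ)).trans e.symm, fun {a b} => ?_⟩, ?_, ?_⟩
  · simp [he, hτ]
  · simp [hσx, τ, Equiv.symm_apply_eq, Prod.ext_iff]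
  · simp [hσy, τ, huv, Equiv.symm_apply_eq, Prod.ext_iff]

theorem circulant_adj_iff {n : ℕ}
    (e : ZMod (16*n+4) ≃+* ZMod 4 × ZMod (4*n+1)) (x y : ZMod (16*n+4)) :
    (circulant (16*n+4) ({1, 4*(n:ℤ)+2, 8*(n:ℤ)+1} : Finset ℤ)).Adj x y ↔
      (e x).1 ≠ (e y).1 ∧ ((e x).2 - (e y).2 = 1 ∨ (e x).2 - (e y).2 = -1) := by
  have h4 : (4 : ZMod 4) = 0 := by decide
  have h8 : (8 : ZMod 4) = 0 := by decide
  have hm : (4 * n + 1 : ZMod (4*n+1)) = 0 := by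
    exact_mod_cast ZMod.natCast_self (4*n+1)
  have h2 : (4 * n + 2 : ZMod (4*n+1)) = 1 := by linear_combination hm
  have h1 : (8 * n + 1 : ZMod (4*n+1)) = -1 := by linear_combination 2 * hm
  have hd : ∀ d, (∃ l ∈ ({1, 4*(n:ℤ)+2, 8*(n:ℤ)+1} : Finset ℤ), d = (l : ZMod (16*n+4))) ↔
      (e d = (1, 1) ∨ e d = (2, 1) ∨ e d = (1, -1)) := by
    intro d
    have e1 : e ((1 : ℤ) : ZMod (16*n+4)) = (1, 1) := by simp [Prod.one_eq_mk]
    have e2 : e ((4*(n:ℤ)+2 : ℤ) : ZMod (16*n+4)) = (2, 1) := by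
      rw [map_intCast]; ext <;> simp [h4, h2]
    have e3 : e ((8*(n:ℤ)+1 : ℤ) : ZMod (16*n+4)) = (1, -1) := by
      rw [map_intCast]; ext <;> simp [h8, h1]
    rw [← e1, ← e2, ← e3]
    simp only [Finset.mem_insert, Finset.mem_singleton, exists_eq_or_imp, exists_eq_left,
      e.injective.eq_iff]
  have key : ∀ p : ZMod 4, p ≠ 0 ↔ p = 1 ∨ p = 2 ∨ p = -1 := by decide
  have hneg : (-2 : ZMod 4) = 2 := by decide
  simp only [circulant, SimpleGraph.circulantGraph_adj, Set.mem_ofPred_eq, hd]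
  rw [← neg_sub x y, map_neg, ← ne_eq, ← sub_ne_zero (a := x), ← sub_ne_zero (a := (e x).1),
    ← Prod.fst_sub, ← Prod.snd_sub, ← map_sub, key, ← (map_ne_zero_iff e e.injective)]
  generalize e (x - y) = d
  obtain ⟨p, q⟩ := d
  simp only [Prod.neg_mk, Prod.mk.injEq, neg_eq_iff_eq_neg, neg_neg, hneg, ne_eq,
    Prod.mk_eq_zero]
  have := key p
  tauto

/-- This circulant graph is edge-transitive for every positive integer `n`. -/
theorem circulant_class_edgeTransitive (n : ℕ) (hn : 0 < n) :
    EdgeTransitive (circulant (16*n+4) ({1, 4*(n:ℤ)+2, 8*(n:ℤ)+1} : Finset ℤ)) := by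
  have hcop : Nat.Coprime 4 (4*n+1) := by simp
  let e : ZMod (16*n+4) ≃+* ZMod 4 × ZMod (4*n+1) :=
    (ZMod.ringEquivCongr (by ring)).trans (ZMod.chineseRemainder hcop)
  exact edgeTransitive_of_equiv_complete_tensor_cycle e.toEquiv (circulant_adj_iff e)
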